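/- arXiv:2304.14468 — 2 statements merged into one kernel-verified Lean document; each statement's English description precedes it below -/
import Mathlib

section
/- Let d = (d_i)_{i∈I} be a sequence in [0,1] indexed by a countable set I such that f_d(α) < ∞ for all α ∈ (0,1). Then f_d is continuous and concave on (0,1), lim_{α→0+} f_d(α) = 0 and lim_{α→1−} f_d(α) = 0, and for all 0 < β ≤ α < 1 one has C_d(α) − D_d(α) = C_d(β) − D_d(β) + #{i ∈ I : β ≤ d_i < α}. In particular, there exists η ∈ [0,1) such that for every α ∈ (0,1) the difference D_d(α) − C_d(α) − η is an integer. -/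
open scoped ENNReal

/-- `C_d(α) = Σ_{i : 0 ≤ d_i < α} d_i`, as a sum in `[0,∞]`. -/
noncomputable def Cfun {I : Type*} (d : I → ℝ) (α : ℝ) : ℝ≥0∞ :=
  ∑' i, if 0 ≤ d i ∧ d i < α then ENNReal.ofReal (d i) else 0

/-- `D_d(α) = Σ_{i : α ≤ d_i ≤ 1} (1 - d_i)`, as a sum in `[0,∞]`. -/
noncomputable def Dfun {I : Type*} (d : I → ℝ) (α : ℝ) : ℝ≥0∞ :=
  ∑' i, if α ≤ d i ∧ d i ≤ 1 then ENNReal.ofReal (1 - d i) else 0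

/-- The majorization function `f_d : ℝ → [0,∞]`. -/
noncomputable def fmaj {I : Type*} (d : I → ℝ) (α : ℝ) : ℝ≥0∞ :=
  if α ≤ 0 then ∑' i, if d i ≤ α then ENNReal.ofReal (α - d i) else 0
  else if α < 1 then ENNReal.ofReal (1 - α) * Cfun d α + ENNReal.ofReal α * Dfun d α
  else ∑' i, if α ≤ d i then ENNReal.ofReal (d i - α) else 0

open Set Filter Topology

/-- On `(0,1)` the majorization function is a sum of minima of two affine functions of `α`. -/
lemma fmaj_eq_tsum_min {I : Type*} {d : I → ℝ} (hd01 : ∀ i, d i ∈ Icc (0 : ℝ) 1)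
    {α : ℝ} (hα : α ∈ Ioo (0 : ℝ) 1) :
    fmaj d α = ∑' i, ENNReal.ofReal (min ((1 - α) * d i) (α * (1 - d i))) := by
  obtain ⟨h0, h1⟩ := hα
  rw [fmaj, if_neg h0.not_ge, if_pos h1, Cfun, Dfun, ← ENNReal.tsum_mul_left,
    ← ENNReal.tsum_mul_left, ← ENNReal.tsum_add]
  refine tsum_congr fun i => ?_
  obtain ⟨hi0, hi1⟩ := hd01 i
  by_cases h : d i < α
  · rw [if_pos ⟨hi0, h⟩, if_neg fun h' => h.not_ge h'.1, mul_zero, add_zero,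
      ← ENNReal.ofReal_mul (by linarith), min_eq_left (by nlinarith)]
  · rw [if_neg fun h' => h h'.2, if_pos ⟨not_lt.1 h, hi1⟩, mul_zero, zero_add,
      ← ENNReal.ofReal_mul h0.le, min_eq_right (by nlinarith)]

lemma min_affine_nonneg {α x : ℝ} (hα : α ∈ Icc (0 : ℝ) 1) (hx : x ∈ Icc (0 : ℝ) 1) :
    0 ≤ min ((1 - α) * x) (α * (1 - x)) :=
  le_min (mul_nonneg (sub_nonneg.2 hα.2) hx.1) (mul_nonneg hα.1 (sub_nonneg.2 hx.2))

lemma min_affine_le {α x : ℝ} (hα : α ∈ Icc (0 : ℝ) 1) (hx : x ∈ Icc (0 : ℝ) 1) :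
    min ((1 - α) * x) (α * (1 - x)) ≤ min x (1 - x) :=
  min_le_min (mul_le_of_le_one_left hx.1 (by linarith [hα.1]))
    (mul_le_of_le_one_left (sub_nonneg.2 hx.2) hα.2)

lemma concaveOn_min_affine (x : ℝ) (s : Set ℝ) (hs : Convex ℝ s) :
    ConcaveOn ℝ s (fun α => min ((1 - α) * x) (α * (1 - x))) := by
  refine ConcaveOn.inf (f := fun α : ℝ => (1 - α) * x) (g := fun α : ℝ => α * (1 - x))
    ⟨hs, fun a _ b _ p q _ _ hpq => le_of_eq ?_⟩ ⟨hs, fun a _ b _ p q _ _ _ => le_of_eq ?_⟩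
  · simp only [smul_eq_mul]
    linear_combination x * hpq
  · simp only [smul_eq_mul]
    ring

lemma hasSum_toReal_Cfun_sub_toReal_Dfun {I : Type*} {d : I → ℝ}
    (hd01 : ∀ i, d i ∈ Icc (0 : ℝ) 1) {α : ℝ} (hα : α ∈ Ioo (0 : ℝ) 1) (hf : fmaj d α < ⊤) :
    HasSum (fun i => if d i < α then d i else d i - 1)
      ((Cfun d α).toReal - (Dfun d α).toReal) := by
  obtain ⟨h0, h1⟩ := hα
  rw [fmaj, if_neg h0.not_ge, if_pos h1, ENNReal.add_lt_top] at hf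
  have hC : Cfun d α ≠ ⊤ := fun h => by
    rw [h, ENNReal.mul_top (by simpa using h1)] at hf
    exact hf.1.ne rfl
  have hD : Dfun d α ≠ ⊤ := fun h => by
    rw [h, ENNReal.mul_top (by simpa using h0)] at hf
    exact hf.2.ne rfl
  have h := (ENNReal.hasSum_toReal hC).sub (ENNReal.hasSum_toReal hD)
  rw [← ENNReal.tsum_toReal_eq fun i => by split_ifs <;> simp,
    ← ENNReal.tsum_toReal_eq fun i => by split_ifs <;> simp] at h
  refine (congrArg (HasSum · _) (funext fun i => ?_)).mp h
  obtain ⟨hi0, hi1⟩ := hd01 i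
  by_cases h : d i < α
  · simp [h, hi0, h.not_ge]
  · simp [h, hi1, not_lt.1 h]

theorem stmt0 {I : Type*} [Countable I] (d : I → ℝ)
    (hd01 : ∀ i, d i ∈ Set.Icc (0 : ℝ) 1)
    (hfin : ∀ α ∈ Set.Ioo (0 : ℝ) 1, fmaj d α < ⊤) :
    ContinuousOn (fun α => (fmaj d α).toReal) (Set.Ioo (0 : ℝ) 1) ∧
    ConcaveOn ℝ (Set.Ioo (0 : ℝ) 1) (fun α => (fmaj d α).toReal) ∧
    Filter.Tendsto (fun α => (fmaj d α).toReal) (nhdsWithin 0 (Set.Ioi (0 : ℝ))) (nhds 0) ∧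
    Filter.Tendsto (fun α => (fmaj d α).toReal) (nhdsWithin 1 (Set.Iio (1 : ℝ))) (nhds 0) ∧
    (∀ α β : ℝ, 0 < β → β ≤ α → α < 1 →
      (Cfun d α).toReal - (Dfun d α).toReal =
        (Cfun d β).toReal - (Dfun d β).toReal +
          (Nat.card {i : I // β ≤ d i ∧ d i < α} : ℝ)) ∧
    ∃ η : ℝ, 0 ≤ η ∧ η < 1 ∧ ∀ α ∈ Set.Ioo (0 : ℝ) 1,
      ∃ k : ℤ, (Dfun d α).toReal - (Cfun d α).toReal - η = (k : ℝ) := by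
  set g : I → ℝ → ℝ := fun i α => min ((1 - α) * d i) (α * (1 - d i)) with hg
  have half_mem : (1 / 2 : ℝ) ∈ Ioo (0 : ℝ) 1 := by norm_num
  have hfg : EqOn (fun α => (fmaj d α).toReal) (fun α => ∑' i, g i α) (Ioo 0 1) := by
    intro α hα
    simp only [fmaj_eq_tsum_min hd01 hα]
    rw [ENNReal.tsum_toReal_eq fun i => ENNReal.ofReal_ne_top]
    exact tsum_congr fun i =>
      ENNReal.toReal_ofReal (min_affine_nonneg (Ioo_subset_Icc_self hα) (hd01 i))
  have hsum_min : Summable fun i => min (d i) (1 - d i) := by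
    have h := hfin _ half_mem
    rw [fmaj_eq_tsum_min hd01 half_mem] at h
    refine ((ENNReal.summable_toReal h.ne).mul_left 2).congr fun i => ?_
    rw [ENNReal.toReal_ofReal (min_affine_nonneg (Ioo_subset_Icc_self half_mem) (hd01 i)),
      mul_min_of_nonneg _ _ zero_le_two]
    congr 1 <;> ring
  have hsum : ∀ α ∈ Icc (0 : ℝ) 1, Summable fun i => g i α := fun α hα =>
    hsum_min.of_nonneg_of_le (fun i => min_affine_nonneg hα (hd01 i))
      fun i => min_affine_le hα (hd01 i)
  have hcont : ContinuousOn (fun α => ∑' i, g i α) (Icc 0 1) := by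
    refine continuousOn_tsum (fun i => ?_) hsum_min fun i α hα => ?_
    · exact Continuous.continuousOn (by fun_prop)
    · rw [Real.norm_of_nonneg (min_affine_nonneg hα (hd01 i))]
      exact min_affine_le hα (hd01 i)
  have hcount : ∀ α β : ℝ, 0 < β → β ≤ α → α < 1 →
      (Cfun d α).toReal - (Dfun d α).toReal =
        (Cfun d β).toReal - (Dfun d β).toReal +
          (Nat.card {i : I // β ≤ d i ∧ d i < α} : ℝ) := by
    intro α β hβ hβα hα
    have hαm : α ∈ Ioo (0 : ℝ) 1 := ⟨hβ.trans_le hβα, hα⟩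
    have hβm : β ∈ Ioo (0 : ℝ) 1 := ⟨hβ, hβα.trans_lt hα⟩
    have h := ((hasSum_toReal_Cfun_sub_toReal_Dfun hd01 hαm (hfin α hαm)).sub
      (hasSum_toReal_Cfun_sub_toReal_Dfun hd01 hβm (hfin β hβm))).tsum_eq
    have hcard : (Nat.card {i : I // β ≤ d i ∧ d i < α} : ℝ) =
        ∑' i, {i : I | β ≤ d i ∧ d i < α}.indicator (fun _ => (1 : ℝ)) i := by
      rw [← tsum_subtype, tsum_const, nsmul_one]
      rfl
    rw [← sub_eq_iff_eq_add', ← h, hcard]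
    refine tsum_congr fun i => ?_
    simp only [indicator_apply, mem_ofPred_eq]
    split_ifs <;> grind
  refine ⟨(hcont.mono Ioo_subset_Icc_self).congr hfg, ?_, ?_, ?_, hcount,
    Int.fract ((Dfun d (1 / 2)).toReal - (Cfun d (1 / 2)).toReal),
    Int.fract_nonneg _, Int.fract_lt_one _, fun α hα => ?_⟩
  · refine ConcaveOn.congr ⟨convex_Ioo 0 1, fun a ha b hb p q hp hq hpq => ?_⟩ hfg.symm
    have hmem := convex_Ioo (0 : ℝ) 1 ha hb hp hq hpq
    have hsa := (hsum a (Ioo_subset_Icc_self ha)).const_smul p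
    have hsb := (hsum b (Ioo_subset_Icc_self hb)).const_smul q
    simp only [← tsum_const_smul'']
    rw [← hsa.tsum_add hsb]
    exact (hsa.add hsb).tsum_le_tsum
      (fun i => (concaveOn_min_affine (d i) _ (convex_Ioo 0 1)).2 ha hb hp hq hpq)
      (hsum _ (Ioo_subset_Icc_self hmem))
  · have h := (hcont 0 (by simp)).mono Ioo_subset_Icc_self
    have h0 : ∑' i, g i 0 = 0 := by
      simp [hg, fun i => (hd01 i).1]
    rw [ContinuousWithinAt, h0, nhdsWithin_Ioo_eq_nhdsGT one_pos] at h
    exact h.congr' (eventually_of_mem (Ioo_mem_nhdsGT one_pos) hfg.symm)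
  · have h := (hcont 1 (by simp)).mono Ioo_subset_Icc_self
    have h1 : ∑' i, g i 1 = 0 := by
      simp [hg, fun i => (hd01 i).2]
    rw [ContinuousWithinAt, h1, nhdsWithin_Ioo_eq_nhdsLT one_pos] at h
    exact h.congr' (eventually_of_mem (Ioo_mem_nhdsLT one_pos) hfg.symm)
  · rw [Int.fract]
    rcases le_total (1 / 2) α with h | h
    · have := hcount α (1 / 2) half_mem.1 h hα.2
      refine ⟨⌊(Dfun d (1 / 2)).toReal - (Cfun d (1 / 2)).toReal⌋ -
        Nat.card {i : I // 1 / 2 ≤ d i ∧ d i < α}, ?_⟩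
      push_cast
      linarith
    · have := hcount (1 / 2) α hα.1 h half_mem.2
      refine ⟨⌊(Dfun d (1 / 2)).toReal - (Cfun d (1 / 2)).toReal⌋ +
        Nat.card {i : I // α ≤ d i ∧ d i < 1 / 2}, ?_⟩
      push_cast
      linarith
end

section
/- Let d = (d_i)_{i∈I} and λ = (λ_j)_{j∈J} be sequences in [0,1] indexed by countable sets with f_d(α) < ∞ and f_λ(α) < ∞ for all α ∈ (0,1). Then the following are equivalent: (i) f_d(α) ≥ f_λ(α) for all α ∈ (0,1); (ii) f_d(λ_j) ≥ f_λ(λ_j) for every j ∈ J with λ_j ∉ {0,1}. -/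
open scoped ENNReal

/-- The sum `Σ_i (min d_i α - α d_i)`, which agrees with `fmaj d α` for `α ∈ (0,1)` and vanishes
at the endpoints when `d` takes values in `[0,1]`. -/
noncomputable def tentSum {I : Type*} (d : I → ℝ) (α : ℝ) : ℝ≥0∞ :=
  ∑' i, ENNReal.ofReal (min (d i) α - α * d i)

theorem fmaj_eq_tentSum {I : Type*} {d : I → ℝ} (hd : ∀ i, d i ∈ Set.Icc (0 : ℝ) 1) {α : ℝ}
    (hα : α ∈ Set.Ioo (0 : ℝ) 1) : fmaj d α = tentSum d α := by
  rw [fmaj, if_neg (not_le.2 hα.1), if_pos hα.2, Cfun, Dfun, ← ENNReal.tsum_mul_left,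
    ← ENNReal.tsum_mul_left, ← ENNReal.tsum_add, tentSum]
  refine tsum_congr fun i => ?_
  obtain ⟨h0, h1⟩ := hd i
  rcases lt_or_ge (d i) α with h | h
  · rw [if_pos ⟨h0, h⟩, if_neg (fun h' => absurd h'.1 (not_le.2 h)), mul_zero, add_zero,
      ← ENNReal.ofReal_mul (by linarith [hα.2]), min_eq_left h.le]
    congr 1; ring
  · rw [if_neg (fun h' => absurd h'.2 (not_lt.2 h)), if_pos ⟨h, h1⟩, mul_zero, zero_add,
      ← ENNReal.ofReal_mul hα.1.le, min_eq_right h]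
    congr 1; ring

theorem tentSum_zero {I : Type*} {d : I → ℝ} (hd : ∀ i, d i ∈ Set.Icc (0 : ℝ) 1) :
    tentSum d 0 = 0 := by
  simp [tentSum, (hd _).1]

theorem tentSum_one {I : Type*} {d : I → ℝ} (hd : ∀ i, d i ∈ Set.Icc (0 : ℝ) 1) :
    tentSum d 1 = 0 := by
  simp [tentSum, (hd _).2]

theorem min_sub_mul_nonneg {x α : ℝ} (hx : x ∈ Set.Icc (0 : ℝ) 1) (hα : α ∈ Set.Icc (0 : ℝ) 1) :
    0 ≤ min x α - α * x := by
  obtain ⟨hx0, hx1⟩ := hx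
  obtain ⟨hα0, hα1⟩ := hα
  rcases min_cases x α with ⟨h, _⟩ | ⟨h, _⟩ <;> rw [h] <;> nlinarith

/-- A convex combination of values of `tentSum d`, written as a single sum. -/
theorem mul_tentSum_add_mul_tentSum {I : Type*} {d : I → ℝ} (hd : ∀ i, d i ∈ Set.Icc (0 : ℝ) 1)
    {a b s t : ℝ} (ha : a ∈ Set.Icc (0 : ℝ) 1) (hb : b ∈ Set.Icc (0 : ℝ) 1)
    (hs : 0 ≤ s) (ht : 0 ≤ t) :
    ENNReal.ofReal s * tentSum d a + ENNReal.ofReal t * tentSum d b =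
      ∑' i, ENNReal.ofReal
        (s * (min (d i) a - a * d i) + t * (min (d i) b - b * d i)) := by
  rw [tentSum, tentSum, ← ENNReal.tsum_mul_left, ← ENNReal.tsum_mul_left, ← ENNReal.tsum_add]
  refine tsum_congr fun i => ?_
  rw [← ENNReal.ofReal_mul hs, ← ENNReal.ofReal_mul ht, ENNReal.ofReal_add
    (mul_nonneg hs (min_sub_mul_nonneg (hd i) ha)) (mul_nonneg ht (min_sub_mul_nonneg (hd i) hb))]

theorem tentSum_concave {I : Type*} {d : I → ℝ} (hd : ∀ i, d i ∈ Set.Icc (0 : ℝ) 1)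
    {a b s t : ℝ} (ha : a ∈ Set.Icc (0 : ℝ) 1) (hb : b ∈ Set.Icc (0 : ℝ) 1)
    (hs : 0 ≤ s) (ht : 0 ≤ t) (hst : s + t = 1) :
    ENNReal.ofReal s * tentSum d a + ENNReal.ofReal t * tentSum d b ≤
      tentSum d (s * a + t * b) := by
  rw [mul_tentSum_add_mul_tentSum hd ha hb hs ht]
  refine ENNReal.tsum_le_tsum fun i => ENNReal.ofReal_le_ofReal ?_
  have hmin : s * min (d i) a + t * min (d i) b ≤ min (d i) (s * a + t * b) := by
    refine le_min ?_ ?_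
    · calc s * min (d i) a + t * min (d i) b ≤ s * d i + t * d i := by
            gcongr <;> exact min_le_left _ _
        _ = d i := by rw [← add_mul, hst, one_mul]
    · gcongr <;> exact min_le_right _ _
  linarith

theorem tentSum_eq_of_gap {I : Type*} {d : I → ℝ} (hd : ∀ i, d i ∈ Set.Icc (0 : ℝ) 1)
    {a b s t : ℝ} (ha : a ∈ Set.Icc (0 : ℝ) 1) (hb : b ∈ Set.Icc (0 : ℝ) 1) (hab : a ≤ b)
    (hs : 0 ≤ s) (ht : 0 ≤ t) (hst : s + t = 1) (hgap : ∀ i, d i ≤ a ∨ b ≤ d i) :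
    tentSum d (s * a + t * b) =
      ENNReal.ofReal s * tentSum d a + ENNReal.ofReal t * tentSum d b := by
  rw [mul_tentSum_add_mul_tentSum hd ha hb hs ht]
  refine tsum_congr fun i => congrArg ENNReal.ofReal ?_
  obtain rfl : s = 1 - t := by linarith
  have hta : a ≤ (1 - t) * a + t * b := by nlinarith
  have htb : (1 - t) * a + t * b ≤ b := by nlinarith
  rcases hgap i with h | h
  · rw [min_eq_left h, min_eq_left (h.trans hab), min_eq_left (h.trans hta)]
    ring
  · rw [min_eq_right h, min_eq_right (hab.trans h), min_eq_right (htb.trans h)]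
    ring

theorem finite_setOf_mem_Icc_of_tentSum_ne_top {I : Type*} {d : I → ℝ} {α : ℝ}
    (hα : α ∈ Set.Ioo (0 : ℝ) 1) (hfin : tentSum d α ≠ ⊤) {c e : ℝ} (hc : 0 < c) (he : e < 1) :
    {i | d i ∈ Set.Icc c e}.Finite := by
  obtain ⟨hα0, hα1⟩ := hα
  have hpos : 0 < min ((1 - α) * c) (α * (1 - e)) :=
    lt_min (mul_pos (by linarith) hc) (mul_pos hα0 (by linarith))
  refine (ENNReal.finite_const_le_of_tsum_ne_top hfin
    (ENNReal.ofReal_pos.2 hpos).ne').subset ?_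
  rintro i ⟨h1, h2⟩
  refine ENNReal.ofReal_le_ofReal ?_
  rcases min_cases (d i) α with ⟨h, _⟩ | ⟨h, _⟩ <;> rw [h]
  · exact (min_le_left _ _).trans (by nlinarith)
  · exact (min_le_right _ _).trans (by nlinarith)

theorem exists_left_neighbor {I : Type*} {d : I → ℝ} (hd : ∀ i, d i ∈ Set.Icc (0 : ℝ) 1)
    {α : ℝ} (hα : α ∈ Set.Ioo (0 : ℝ) 1) (hfin : tentSum d α ≠ ⊤) :
    ∃ a, 0 ≤ a ∧ a < α ∧ (a = 0 ∨ ∃ i, d i = a) ∧ ∀ i, d i < α → d i ≤ a := by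
  by_cases h : ∃ k, 0 < d k ∧ d k < α
  · obtain ⟨k, hk0, hkα⟩ := h
    have hS : {i | d i ∈ Set.Ico (d k) α}.Finite :=
      (finite_setOf_mem_Icc_of_tentSum_ne_top hα hfin hk0 hα.2).subset
        fun i hi => ⟨hi.1, hi.2.le⟩
    obtain ⟨m, hm, hmax⟩ := Set.exists_max_image _ d hS ⟨k, le_rfl, hkα⟩
    refine ⟨d m, (hd m).1, hm.2, Or.inr ⟨m, rfl⟩, fun i hi => ?_⟩
    rcases le_total (d k) (d i) with hki | hik
    · exact hmax i ⟨hki, hi⟩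
    · exact hik.trans hm.1
  · push Not at h
    exact ⟨0, le_rfl, hα.1, Or.inl rfl,
      fun i hi => le_of_not_gt fun h0 => absurd hi (not_lt.2 (h i h0))⟩

theorem exists_right_neighbor {I : Type*} {d : I → ℝ} (hd : ∀ i, d i ∈ Set.Icc (0 : ℝ) 1)
    {α : ℝ} (hα : α ∈ Set.Ioo (0 : ℝ) 1) (hfin : tentSum d α ≠ ⊤) :
    ∃ b, b ≤ 1 ∧ α < b ∧ (b = 1 ∨ ∃ i, d i = b) ∧ ∀ i, α < d i → b ≤ d i := by
  by_cases h : ∃ k, d k < 1 ∧ α < d k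
  · obtain ⟨k, hk1, hkα⟩ := h
    have hS : {i | d i ∈ Set.Ioc α (d k)}.Finite :=
      (finite_setOf_mem_Icc_of_tentSum_ne_top hα hfin hα.1 hk1).subset
        fun i hi => ⟨hi.1.le, hi.2⟩
    obtain ⟨m, hm, hmin⟩ := Set.exists_min_image _ d hS ⟨k, hkα, le_rfl⟩
    refine ⟨d m, (hd m).2, hm.1, Or.inr ⟨m, rfl⟩, fun i hi => ?_⟩
    rcases le_total (d i) (d k) with hik | hki
    · exact hmin i ⟨hi, hik⟩
    · exact hm.2.trans hki
  · push Not at h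
    exact ⟨1, le_rfl, hα.2, Or.inl rfl,
      fun i hi => le_of_not_gt fun h1 => absurd hi (not_lt.2 (h i h1))⟩

theorem stmt1 {I J : Type*} [Countable I] [Countable J]
    (d : I → ℝ) (lam : J → ℝ)
    (hd01 : ∀ i, d i ∈ Set.Icc (0 : ℝ) 1) (hlam01 : ∀ j, lam j ∈ Set.Icc (0 : ℝ) 1)
    (hdfin : ∀ α ∈ Set.Ioo (0 : ℝ) 1, fmaj d α < ⊤)
    (hlamfin : ∀ α ∈ Set.Ioo (0 : ℝ) 1, fmaj lam α < ⊤) :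
    (∀ α ∈ Set.Ioo (0 : ℝ) 1, fmaj lam α ≤ fmaj d α) ↔
      (∀ j : J, lam j ≠ 0 → lam j ≠ 1 → fmaj lam (lam j) ≤ fmaj d (lam j)) := by
  have hIoo : ∀ j, lam j ≠ 0 → lam j ≠ 1 → lam j ∈ Set.Ioo (0 : ℝ) 1 := fun j h0 h1 =>
    ⟨lt_of_le_of_ne (hlam01 j).1 h0.symm, lt_of_le_of_ne (hlam01 j).2 h1⟩
  refine ⟨fun h j h0 h1 => h _ (hIoo j h0 h1), fun h α hα => ?_⟩
  by_cases hmem : ∃ j, lam j = α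
  · obtain ⟨j, rfl⟩ := hmem
    exact h j hα.1.ne' hα.2.ne
  have hnode : ∀ j, tentSum lam (lam j) ≤ tentSum d (lam j) := by
    intro j
    by_cases h0 : lam j = 0
    · rw [h0, tentSum_zero hlam01]; exact zero_le
    by_cases h1 : lam j = 1
    · rw [h1, tentSum_one hlam01]; exact zero_le
    rw [← fmaj_eq_tentSum hlam01 (hIoo j h0 h1), ← fmaj_eq_tentSum hd01 (hIoo j h0 h1)]
    exact h j h0 h1
  have hfin : tentSum lam α ≠ ⊤ := fmaj_eq_tentSum hlam01 hα ▸ (hlamfin α hα).ne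
  obtain ⟨a, ha0, haα, ha, hleft⟩ := exists_left_neighbor hlam01 hα hfin
  obtain ⟨b, hb1, hαb, hb, hright⟩ := exists_right_neighbor hlam01 hα hfin
  have hla : tentSum lam a ≤ tentSum d a := by
    rcases ha with rfl | ⟨j, rfl⟩
    · rw [tentSum_zero hlam01]; exact zero_le
    · exact hnode j
  have hlb : tentSum lam b ≤ tentSum d b := by
    rcases hb with rfl | ⟨j, rfl⟩
    · rw [tentSum_one hlam01]; exact zero_le
    · exact hnode j
  have hgap : ∀ j, lam j ≤ a ∨ b ≤ lam j := fun j =>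
    (lt_or_gt_of_ne fun hj => hmem ⟨j, hj⟩).imp (hleft j) (hright j)
  have haI : a ∈ Set.Icc (0 : ℝ) 1 := ⟨ha0, (haα.trans hα.2).le⟩
  have hbI : b ∈ Set.Icc (0 : ℝ) 1 := ⟨(hα.1.trans hαb).le, hb1⟩
  have hseg : α ∈ segment ℝ a b := by
    rw [segment_eq_Icc (haα.trans hαb).le]
    exact ⟨haα.le, hαb.le⟩
  obtain ⟨s, t, hs, ht, hst, hcomb⟩ := hseg
  simp only [smul_eq_mul] at hcomb
  rw [fmaj_eq_tentSum hlam01 hα, fmaj_eq_tentSum hd01 hα, ← hcomb,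
    tentSum_eq_of_gap hlam01 haI hbI (haα.trans hαb).le hs ht hst hgap]
  calc _ ≤ ENNReal.ofReal s * tentSum d a + ENNReal.ofReal t * tentSum d b := by gcongr
    _ ≤ _ := tentSum_concave hd01 haI hbI hs ht hst
end
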